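/- Let L be a complex inner product space, N ≥ 1, and u₁, …, u_N ∈ L such that u_j ≠ 0 for all j and for all i ≠ j one has u_i ≠ u_j and u_i ≠ −u_j. If complex numbers α₁, …, α_N satisfy Σ_{j=1}^N α_j · sinh(⟨x, u_j⟩) = 0 for every x ∈ L, then α_j = 0 for all j. (This expresses the linear independence of the odd exponential vectors e⁻(u₁), …, e⁻(u_N) in the odd part of the Boson Fock space, since ⟨e⁻(x), e⁻(u)⟩ = sinh⟨x, u⟩.) -/

import Mathlib

open scoped InnerProductSpace

/-- The exponential character `x ↦ exp ⟪x, v⟫`. -/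
noncomputable def expChar {L : Type*} [NormedAddCommGroup L] [InnerProductSpace ℂ L] (v : L) :
    Multiplicative L →* ℂ where
  toFun x := Complex.exp (⟪x.toAdd, v⟫_ℂ)
  map_one' := by simp
  map_mul' x y := by simp [inner_add_left, Complex.exp_add]

theorem expChar_injective {L : Type*} [NormedAddCommGroup L] [InnerProductSpace ℂ L] :
    Function.Injective (expChar : L → Multiplicative L →* ℂ) := by
  intro v w hvw
  have h1 : Complex.exp (⟪v - w, v⟫_ℂ) = Complex.exp (⟪v - w, w⟫_ℂ) :=
    DFunLike.congr_fun hvw (Multiplicative.ofAdd (v - w))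
  have h2 : Complex.exp (⟪v - w, v - w⟫_ℂ) = 1 := by
    rw [inner_sub_right, Complex.exp_sub, h1, div_self (Complex.exp_ne_zero _)]
  rw [inner_self_eq_norm_sq_to_K] at h2
  have h3 : Real.exp (‖v - w‖ ^ 2) = 1 := by
    apply Complex.ofReal_injective
    push_cast
    exact h2
  rw [Real.exp_eq_one_iff] at h3
  exact sub_eq_zero.mp (norm_eq_zero.mp (pow_eq_zero_iff two_ne_zero |>.mp h3))

/-- **Linear independence of odd exponential vectors.**
If `u₁, …, u_N` are nonzero vectors in a complex inner product space with `uᵢ ≠ ±uⱼ` for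
`i ≠ j`, and `∑ⱼ αⱼ sinh ⟪x, uⱼ⟫ = 0` for every `x`, then all `αⱼ = 0`. -/
theorem odd_exponential_vectors_linearly_independent
    {L : Type*} [NormedAddCommGroup L] [InnerProductSpace ℂ L]
    (N : ℕ) (hN : 1 ≤ N) (u : Fin N → L)
    (hu0 : ∀ j : Fin N, u j ≠ 0)
    (hu : ∀ i j : Fin N, i ≠ j → u i ≠ u j ∧ u i ≠ -u j)
    (α : Fin N → ℂ)
    (h : ∀ x : L, ∑ j : Fin N, α j * Complex.sinh (⟪x, u j⟫_ℂ) = 0) :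
    ∀ j : Fin N, α j = 0 := by
  have hself : ∀ j, u j ≠ -u j := by
    intro j hj
    have h2 : (2 : ℂ) • u j = 0 := by
      rw [two_smul]
      exact eq_neg_iff_add_eq_zero.mp hj
    exact hu0 j ((smul_eq_zero.mp h2).resolve_left two_ne_zero)
  have hinj : Function.Injective (Sum.elim u (fun j => -u j)) := by
    have key : ∀ i j, u i ≠ -u j := by
      intro i j
      by_cases hij : i = j
      · subst hij; exact hself i
      · exact (hu i j hij).2
    have key2 : ∀ i j, u i = u j → i = j := by
      intro i j hij
      by_contra hne
      exact (hu i j hne).1 hij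
    rintro (i | i) (j | j) hij
    · exact congrArg _ (key2 i j hij)
    · exact (key i j hij).elim
    · exact (key j i hij.symm).elim
    · exact congrArg _ (key2 i j (neg_injective hij))
  have hli := (linearIndependent_monoidHom (Multiplicative L) ℂ).comp _
    (expChar_injective.comp hinj)
  rw [Fintype.linearIndependent_iff] at hli
  have := hli (Sum.elim α (fun j => -α j)) (by
    funext x
    have hx := h x.toAdd
    have hx2 : ∑ j : Fin N, (α j * Complex.exp (⟪x.toAdd, u j⟫_ℂ)
        + -α j * Complex.exp (-⟪x.toAdd, u j⟫_ℂ)) = 0 := by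
      calc _ = 2 * ∑ j : Fin N, α j * Complex.sinh (⟪x.toAdd, u j⟫_ℂ) := by
            rw [Finset.mul_sum]
            refine Finset.sum_congr rfl fun j _ => ?_
            rw [Complex.sinh]
            ring
        _ = 0 := by rw [hx, mul_zero]
    rw [Finset.sum_add_distrib] at hx2
    simpa [Fintype.sum_sum_type, expChar] using hx2)
  intro j
  exact this (Sum.inl j)
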